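/- Fix x⋆ ∈ S and define, for k ≥ 1, v_k = (x_{k−1} − x⋆) + t_k (x_k − x_{k−1} + β_{k−1}√(s_{k−1}) ∇f(x_{k−1})) and M_k = β_k √(s_k) t_{k+1} M^x_k − β_{k−1} √(s_{k−1}) t_k M^x_{k−1} + s_k t_{k+1} M^y_k. Then there exist an integer k_0 ≥ 1 and a sequence (ε_k) with ε_k ∈ (0, β_k(2√(s_k) − β_k)] for every k, such that for all k ≥ k_0: [s_{k+1} t_{k+1}² (f(x_{k+1}) − min f) + (1/2)‖v_{k+1}‖² + ⟨v_{k+1}, M_k⟩] − [s_k t_k² (f(x_k) − min f) + (1/2)‖v_k‖²] ≤ s_k (t_{k+1}² − t_{k+1} − t_k²)(f(x_k) − min f) − (ε_k/4) s_k t_{k+1}² ‖∇f(y_k)‖² + (s_k²/2) t_{k+1}² ‖M^y_k‖² + β_k² s_k t_{k+1}² (2 s_k/ε_k + 1) ‖M^x_k‖² + β_{k−1}² s_{k−1} t_k² (2 s_k/ε_k + 1) ‖M^x_{k−1}‖². -/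

import Mathlib

set_option autoImplicit false

open scoped RealInnerProductSpace

section ConvexSmooth

variable {H : Type*} [NormedAddCommGroup H] [InnerProductSpace ℝ H] [CompleteSpace H]

/-- The derivative of a function along a line, expressed through its gradient. -/
theorem hasDerivAt_line_of_hasGradientAt {f : H → ℝ} {f' : H → H}
    (hdiff : ∀ z, HasGradientAt f (f' z) z) (z d : H) (τ : ℝ) :
    HasDerivAt (fun τ : ℝ => f (z + τ • d)) ⟪f' (z + τ • d), d⟫ τ := by
  have hline : HasDerivAt (fun τ : ℝ => z + τ • d) d τ := by
    simpa using ((hasDerivAt_id τ).smul_const d).const_add z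
  have h := (hdiff (z + τ • d)).hasFDerivAt.comp_hasDerivAt τ hline
  rwa [InnerProductSpace.toDual_apply_apply] at h

/-- The gradient inequality for a differentiable convex function. -/
theorem ConvexOn.add_inner_gradient_le {f : H → ℝ} {f' : H → H}
    (hconv : ConvexOn ℝ Set.univ f) (hdiff : ∀ z, HasGradientAt f (f' z) z) (z w : H) :
    f z + ⟪f' z, w - z⟫ ≤ f w := by
  have hline : ConvexOn ℝ Set.univ (fun τ : ℝ => f (z + τ • (w - z))) := by
    have h := hconv.comp_affineMap (AffineMap.lineMap (k := ℝ) z w)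
    simpa [Function.comp_def, AffineMap.lineMap_apply, add_comm] using h
  have h := hline.le_slope_of_hasDerivAt (Set.mem_univ 0) (Set.mem_univ 1) zero_lt_one
    (hasDerivAt_line_of_hasGradientAt hdiff z (w - z) 0)
  simp [slope_def_field] at h
  linarith

/-- The descent lemma for a function with Lipschitz gradient. -/
theorem le_add_inner_add_of_lipschitz_gradient {f : H → ℝ} {f' : H → H} {L : ℝ}
    (hdiff : ∀ z, HasGradientAt f (f' z) z)
    (hlip : ∀ z w, ‖f' z - f' w‖ ≤ L * ‖z - w‖) (z d : H) :
    f (z + d) ≤ f z + ⟪f' z, d⟫ + L / 2 * ‖d‖ ^ 2 := by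
  let φ : ℝ → ℝ := fun τ => f (z + τ • d) - (τ * ⟪f' z, d⟫ + L / 2 * ‖d‖ ^ 2 * τ ^ 2)
  have hφ (τ : ℝ) : HasDerivAt φ
      (⟪f' (z + τ • d), d⟫ - (⟪f' z, d⟫ + L * ‖d‖ ^ 2 * τ)) τ := by
    refine (hasDerivAt_line_of_hasGradientAt hdiff z d τ).sub ?_
    refine (((hasDerivAt_id τ).mul_const ⟪f' z, d⟫).add
      (((hasDerivAt_id τ).pow 2).const_mul (L / 2 * ‖d‖ ^ 2))).congr_deriv ?_
    simp
    ring
  have hanti : AntitoneOn φ (Set.Icc 0 1) := by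
    refine antitoneOn_of_deriv_nonpos (convex_Icc 0 1)
      (fun τ _ => (hφ τ).continuousAt.continuousWithinAt)
      (fun τ _ => (hφ τ).differentiableAt.differentiableWithinAt) fun τ hτ => ?_
    rw [interior_Icc] at hτ
    rw [(hφ τ).deriv]
    have h₁ : ⟪f' (z + τ • d) - f' z, d⟫ ≤ ‖f' (z + τ • d) - f' z‖ * ‖d‖ :=
      real_inner_le_norm _ _
    have h₂ := hlip (z + τ • d) z
    rw [add_sub_cancel_left, norm_smul, Real.norm_of_nonneg hτ.1.le] at h₂
    have h₃ := mul_le_mul_of_nonneg_right h₂ (norm_nonneg d)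
    rw [inner_sub_left] at h₁
    nlinarith
  have h := hanti (Set.left_mem_Icc.2 zero_le_one) (Set.right_mem_Icc.2 zero_le_one) zero_le_one
  simp [φ] at h
  linarith

/-- The gradient inequality of a smooth convex function, improved by a multiple of the squared
distance between the gradients. -/
theorem ConvexOn.add_inner_gradient_add_le {f : H → ℝ} {f' : H → H} {L σ : ℝ}
    (hconv : ConvexOn ℝ Set.univ f) (hdiff : ∀ z, HasGradientAt f (f' z) z)
    (hlip : ∀ z w, ‖f' z - f' w‖ ≤ L * ‖z - w‖) (hσ : 0 ≤ σ) (hσL : L * σ ≤ 1) (z w : H) :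
    f z + ⟪f' z, w - z⟫ + σ / 2 * ‖f' w - f' z‖ ^ 2 ≤ f w := by
  have hlow := hconv.add_inner_gradient_le hdiff z (w + (-σ) • (f' w - f' z))
  have hup := le_add_inner_add_of_lipschitz_gradient hdiff hlip w ((-σ) • (f' w - f' z))
  have hsq : ‖(-σ) • (f' w - f' z)‖ ^ 2 = σ ^ 2 * ‖f' w - f' z‖ ^ 2 := by
    rw [norm_smul, mul_pow, Real.norm_eq_abs, sq_abs, neg_sq]
  have hinner : ⟪f' w, f' w - f' z⟫ - ⟪f' z, f' w - f' z⟫ = ‖f' w - f' z‖ ^ 2 := by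
    rw [← inner_sub_left, real_inner_self_eq_norm_sq]
  rw [hsq, real_inner_smul_right] at hup
  rw [add_sub_right_comm, inner_add_right, real_inner_smul_right] at hlow
  have hbound := mul_le_mul_of_nonneg_right hσL (mul_nonneg hσ (sq_nonneg ‖f' w - f' z‖))
  linear_combination hlow + hup + hbound / 2 - σ * hinner

/-- One inexact gradient step with step size at most `1 / L` decreases the function by at least
`σ / 2 * ‖f' z‖ ^ 2`, up to the squared size of the error. -/
theorem inexact_gradient_step_le {f : H → ℝ} {f' : H → H} {L σ : ℝ}
    (hdiff : ∀ z, HasGradientAt f (f' z) z)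
    (hlip : ∀ z w, ‖f' z - f' w‖ ≤ L * ‖z - w‖) (hσ : 0 ≤ σ) (hσL : L * σ ≤ 1) (z p : H) :
    f (z - σ • (f' z + p)) ≤ f z - σ / 2 * ‖f' z‖ ^ 2 + σ / 2 * ‖p‖ ^ 2 := by
  have hup := le_add_inner_add_of_lipschitz_gradient hdiff hlip z ((-σ) • (f' z + p))
  have hsq : ‖(-σ) • (f' z + p)‖ ^ 2 = σ ^ 2 * ‖f' z + p‖ ^ 2 := by
    rw [norm_smul, mul_pow, Real.norm_eq_abs, sq_abs, neg_sq]
  rw [hsq, real_inner_smul_right, neg_smul, ← sub_eq_add_neg, inner_add_right,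
    real_inner_self_eq_norm_sq] at hup
  have hbound := mul_le_mul_of_nonneg_right hσL (mul_nonneg hσ (sq_nonneg ‖f' z + p‖))
  linear_combination hup + hbound / 2 + σ / 2 * norm_add_sq_real (f' z) p

end ConvexSmooth

section InnerProduct

variable {H : Type*} [NormedAddCommGroup H] [InnerProductSpace ℝ H]

/-- The quadratic form in the two gradients that produces the dissipation of the Lyapunov
function. -/
theorem gradient_dissipation_le {r b T : ℝ} (hr : 0 < r) (hb : 0 < b) (hbr : b ≤ r / 2)
    (hT : 4 / 3 ≤ T) (h g : H) :
    b * (2 * r - b) * T ^ 2 * ‖h‖ ^ 2 ≤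
      r ^ 2 * (T ^ 2 - T) * ‖h - g‖ ^ 2 + r ^ 2 * T * ‖h‖ ^ 2
        + 2 * (b * r) * T ^ 2 * ⟪h, g⟫ := by
  have hdisc : 0 ≤ T * (r ^ 2 - b ^ 2) - r ^ 2 := by
    nlinarith [mul_nonneg (sub_nonneg.2 hT) (show 0 ≤ r ^ 2 - b ^ 2 by nlinarith)]
  have hC : 0 < r ^ 2 * (T ^ 2 - T) := mul_pos (by positivity) (by nlinarith)
  have hsq := sq_nonneg
    ‖(r ^ 2 * (T ^ 2 - T)) • g - (r * T * (r * (T - 1) - T * b)) • h‖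
  rw [norm_sub_sq_real, norm_smul, norm_smul, mul_pow, mul_pow, Real.norm_eq_abs,
    Real.norm_eq_abs, sq_abs, sq_abs, real_inner_smul_left, real_inner_smul_right,
    real_inner_comm] at hsq
  have hrest : 0 ≤ r ^ 2 * T ^ 2 * (T * (r ^ 2 - b ^ 2) - r ^ 2) * ‖h‖ ^ 2 := by positivity
  refine le_of_mul_le_mul_left ?_ hC
  rw [norm_sub_sq_real]
  linear_combination hsq + hrest

/-- Young's inequality for the inner product against a difference of two vectors. -/
theorem neg_inner_sub_le_of_pos {c σ T : ℝ} (hc : 0 < c) (hσ : 0 ≤ σ) (h p q : H) :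
    -(σ * T * ⟪p - q, h⟫) ≤
      c / 4 * σ * T ^ 2 * ‖h‖ ^ 2 + 2 * σ / c * ‖p‖ ^ 2 + 2 * σ / c * ‖q‖ ^ 2 := by
  have hsq := sq_nonneg ‖(c * T / 2) • h + (p - q)‖
  rw [norm_add_sq_real, norm_smul, mul_pow, Real.norm_eq_abs, sq_abs, real_inner_smul_left,
    real_inner_comm] at hsq
  have hpar := parallelogram_law_with_norm ℝ p q
  have hadd := sq_nonneg ‖p + q‖
  have hle : 0 ≤ (c * T / 2) ^ 2 * ‖h‖ ^ 2 + c * T * ⟪p - q, h⟫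
      + 2 * ‖p‖ ^ 2 + 2 * ‖q‖ ^ 2 := by
    nlinarith
  have hmul := mul_nonneg (div_nonneg hσ hc.le) hle
  have hexp : σ / c * ((c * T / 2) ^ 2 * ‖h‖ ^ 2 + c * T * ⟪p - q, h⟫
      + 2 * ‖p‖ ^ 2 + 2 * ‖q‖ ^ 2) =
      c / 4 * σ * T ^ 2 * ‖h‖ ^ 2 + 2 * σ / c * ‖p‖ ^ 2 + 2 * σ / c * ‖q‖ ^ 2
        + σ * T * ⟪p - q, h⟫ := by
    field_simp
    ring
  linarith

/-- The variation of the perturbed kinetic energy. -/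
theorem half_norm_sq_add_inner_sub_half_norm_sq {v w m n : H} (hvw : w = v + (m + n)) :
    1 / 2 * ‖v‖ ^ 2 + ⟪v, m⟫ - 1 / 2 * ‖w‖ ^ 2 = -⟪v, n⟫ - 1 / 2 * ‖m + n‖ ^ 2 := by
  rw [hvw, norm_add_sq_real v, inner_add_right]
  ring

end InnerProduct

/-- Main Lyapunov estimate (Lemma 2.1) for the inexact IGAHD algorithm. -/
theorem igahd_main_estimate
    {H : Type*} [NormedAddCommGroup H] [InnerProductSpace ℝ H] [CompleteSpace H]
    (f : H → ℝ) (f' : H → H) (L : ℝ) (hL : 0 < L)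
    (hconv : ConvexOn ℝ Set.univ f)
    (hdiff : ∀ z, HasGradientAt f (f' z) z)
    (hlip : ∀ z w, ‖f' z - f' w‖ ≤ L * ‖z - w‖)
    (xstar : H) (hmin : ∀ z, f xstar ≤ f z)
    (α : ℝ) (hα : 3 ≤ α)
    (s β : ℕ → ℝ) (hs0 : s 0 = 0) (hβ0 : β 0 = 0)
    (hs_pos : ∀ k, 1 ≤ k → 0 < s k) (hs_le : ∀ k, 1 ≤ k → s k ≤ 1 / L)
    (hs_dec : ∀ k, 1 ≤ k → s (k + 1) ≤ s k)
    (hβ_pos : ∀ k, 1 ≤ k → 0 < β k)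
    (hβ_le : ∀ k, 1 ≤ k → β k ≤ Real.sqrt (s k) / 2)
    (x y Mx My : ℕ → H)
    (hx_init : x 1 = x 0)
    (hy : ∀ k, 1 ≤ k → y k = x k + (1 - α / (k : ℝ)) • (x k - x (k - 1))
        - (β k * Real.sqrt (s k)) • (f' (x k) + Mx k)
        + (β (k - 1) * Real.sqrt (s (k - 1)) * (1 - 1 / (k : ℝ))) •
            (f' (x (k - 1)) + Mx (k - 1)))
    (hx : ∀ k, 1 ≤ k → x (k + 1) = y k - s k • (f' (y k) + My k)) :
    -- `t (k+1) = k / (α − 1)`, i.e. `t k = (k − 1)/(α − 1)` for `k ≥ 1`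
    let t : ℕ → ℝ := fun k => ((k : ℝ) - 1) / (α - 1)
    let v : ℕ → H := fun k => (x (k - 1) - xstar) +
      t k • (x k - x (k - 1) + (β (k - 1) * Real.sqrt (s (k - 1))) • f' (x (k - 1)))
    let M : ℕ → H := fun k =>
      ((β k * Real.sqrt (s k) * t (k + 1)) • Mx k
        - (β (k - 1) * Real.sqrt (s (k - 1)) * t k) • Mx (k - 1))
      + (s k * t (k + 1)) • My k
    ∃ k0 : ℕ, 1 ≤ k0 ∧ ∃ ε : ℕ → ℝ,
      (∀ k, 1 ≤ k → 0 < ε k ∧ ε k ≤ β k * (2 * Real.sqrt (s k) - β k)) ∧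
      ∀ k, k0 ≤ k →
        (s (k + 1) * t (k + 1) ^ 2 * (f (x (k + 1)) - f xstar)
            + 1 / 2 * ‖v (k + 1)‖ ^ 2 + ⟪v (k + 1), M k⟫)
          - (s k * t k ^ 2 * (f (x k) - f xstar) + 1 / 2 * ‖v k‖ ^ 2)
        ≤ s k * (t (k + 1) ^ 2 - t (k + 1) - t k ^ 2) * (f (x k) - f xstar)
          - ε k / 4 * s k * t (k + 1) ^ 2 * ‖f' (y k)‖ ^ 2
          + s k ^ 2 / 2 * t (k + 1) ^ 2 * ‖My k‖ ^ 2
          + β k ^ 2 * s k * t (k + 1) ^ 2 * (2 * s k / ε k + 1) * ‖Mx k‖ ^ 2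
          + β (k - 1) ^ 2 * s (k - 1) * t k ^ 2 * (2 * s k / ε k + 1) * ‖Mx (k - 1)‖ ^ 2 := by
  intro t v M
  obtain ⟨k0, hk0⟩ := exists_nat_ge (4 / 3 * (α - 1))
  have hr_pos (k : ℕ) (hk : 1 ≤ k) : 0 < √(s k) := Real.sqrt_pos.2 (hs_pos k hk)
  have hε_pos (k : ℕ) (hk : 1 ≤ k) : 0 < β k * (2 * √(s k) - β k) :=
    mul_pos (hβ_pos k hk) (by linarith [hβ_le k hk, hr_pos k hk])
  refine ⟨max k0 1, le_max_right _ _, fun k => β k * (2 * √(s k) - β k),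
    fun k hk => ⟨hε_pos k hk, le_rfl⟩, fun k hk => ?_⟩
  have hk1 : 1 ≤ k := (le_max_right _ _).trans hk
  have hkpos : (0 : ℝ) < k := by exact_mod_cast hk1
  have hα1 : 0 < α - 1 := by linarith
  have hT : 4 / 3 ≤ t (k + 1) := by
    have hk0k : (k0 : ℝ) ≤ k := by exact_mod_cast (le_max_left _ _).trans hk
    simp only [t]
    rw [le_div_iff₀ hα1]
    push_cast
    linarith
  have hTα : t (k + 1) * (1 - α / k) = t k - 1 := by
    simp only [t]
    push_cast
    field_simp
    ring
  have hTt : t (k + 1) * (1 - 1 / (k : ℝ)) = t k := by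
    simp only [t]
    push_cast
    field_simp
    ring
  have hs0' : 0 ≤ s (k - 1) := by
    rcases Nat.eq_zero_or_pos (k - 1) with h | h
    · rw [h, hs0]
    · exact (hs_pos _ h).le
  have hs := hs_pos k hk1
  have hsL : L * s k ≤ 1 := by
    have := hs_le k hk1
    rw [le_div_iff₀ hL] at this
    linarith
  have hr2 : √(s k) ^ 2 = s k := Real.sq_sqrt hs.le
  have hr2' : √(s (k - 1)) ^ 2 = s (k - 1) := Real.sq_sqrt hs0'
  clear_value t
  have hvk : v k = v (k + 1) + (M k + (s k * t (k + 1)) • f' (y k)) := by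
    simp only [v, M, Nat.add_sub_cancel]
    rw [hx k hk1, hy k hk1]
    linear_combination (norm := module) -(hTα • (x k - x (k - 1)))
      - (β (k - 1) * √(s (k - 1))) • hTt • (f' (x (k - 1)) + Mx (k - 1))
  have hv : ⟪v (k + 1), f' (y k)⟫ = ⟪f' (y k), x k - xstar⟫
      + t (k + 1) * (⟪f' (y k), y k - x k⟫ - s k * (‖f' (y k)‖ ^ 2 + ⟪f' (y k), My k⟫)
        + β k * √(s k) * ⟪f' (y k), f' (x k)⟫) := by
    have hvec : v (k + 1) = (x k - xstar) + t (k + 1) • ((y k - x k)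
        - s k • (f' (y k) + My k) + (β k * √(s k)) • f' (x k)) := by
      simp only [v, Nat.add_sub_cancel]
      rw [hx k hk1]
      module
    rw [hvec, real_inner_comm]
    simp only [inner_add_right, inner_sub_right _ (y k - x k), real_inner_smul_right,
      real_inner_self_eq_norm_sq]
  have hM : ⟪M k, f' (y k)⟫ = ⟪(β k * √(s k) * t (k + 1)) • Mx k
      - (β (k - 1) * √(s (k - 1)) * t k) • Mx (k - 1), f' (y k)⟫
        + s k * t (k + 1) * ⟪f' (y k), My k⟫ := by
    simp only [M]
    rw [inner_add_left, real_inner_smul_left, real_inner_comm (f' (y k)) (My k)]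
  clear_value v M
  have hkin := half_norm_sq_add_inner_sub_half_norm_sq hvk
  rw [norm_add_sq_real, real_inner_smul_right, real_inner_smul_right, norm_smul, mul_pow,
    Real.norm_eq_abs, sq_abs, hv, hM] at hkin
  have hyoung := neg_inner_sub_le_of_pos (T := t (k + 1)) (hε_pos k hk1) hs.le (f' (y k))
    ((β k * √(s k) * t (k + 1)) • Mx k) ((β (k - 1) * √(s (k - 1)) * t k) • Mx (k - 1))
  simp only [norm_smul, mul_pow, Real.norm_eq_abs, sq_abs, hr2, hr2'] at hyoung
  have hdiss := gradient_dissipation_le (hr_pos k hk1) (hβ_pos k hk1) (hβ_le k hk1) hT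
    (f' (y k)) (f' (x k))
  rw [hr2] at hdiss
  have hstep := inexact_gradient_step_le hdiff hlip hs.le hsL (y k) (My k)
  rw [← hx k hk1] at hstep
  have hxk := hconv.add_inner_gradient_add_le hdiff hlip hs.le hsL (y k) (x k)
  rw [norm_sub_rev (f' (x k)), ← neg_sub (y k) (x k), inner_neg_right] at hxk
  have hgrad : f' xstar = 0 := by
    have h := inexact_gradient_step_le hdiff hlip hs.le hsL xstar 0
    have hle := hmin (xstar - s k • (f' xstar + 0))
    rw [norm_zero] at h
    have hsq : ‖f' xstar‖ ^ 2 ≤ 0 := by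
      by_contra! hpos
      have := mul_pos hs hpos
      linarith
    simpa using hsq.antisymm (sq_nonneg _)
  have hxstar := hconv.add_inner_gradient_add_le hdiff hlip hs.le hsL (y k) xstar
  rw [hgrad, zero_sub, norm_neg, show xstar - y k = -((y k - x k) + (x k - xstar)) by abel,
    inner_neg_right, inner_add_right] at hxstar
  have hT0 : 0 ≤ t (k + 1) := by linarith
  have hTT : 0 ≤ t (k + 1) ^ 2 - t (k + 1) := by nlinarith
  have hdec := mul_le_mul_of_nonneg_right (hs_dec k hk1)
    (mul_nonneg (sq_nonneg (t (k + 1))) (sub_nonneg.2 (hmin (x (k + 1)))))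
  have hstep' := mul_le_mul_of_nonneg_left hstep (mul_nonneg hs.le (sq_nonneg (t (k + 1))))
  have hxk' := mul_le_mul_of_nonneg_left hxk (mul_nonneg hs.le hTT)
  have hxstar' := mul_le_mul_of_nonneg_left hxstar (mul_nonneg hs.le hT0)
  have hdiss' := mul_le_mul_of_nonneg_left hdiss hs.le
  have hMsq := sq_nonneg ‖M k‖
  have hx0 : 0 ≤ β k ^ 2 * s k * t (k + 1) ^ 2 * ‖Mx k‖ ^ 2 := by positivity
  have hx1 : 0 ≤ β (k - 1) ^ 2 * s (k - 1) * t k ^ 2 * ‖Mx (k - 1)‖ ^ 2 := by positivity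
  beta_reduce
  linear_combination hkin + hyoung + hdec + hstep' + hxk' + hxstar' + hdiss' / 2 + hMsq / 2
    + hx0 + hx1
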